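/- Let N be a positive integer. The map z ↦ N·z of the upper half plane ℍ to itself descends to a well-defined bijection from the quotient of ℍ by the action of the subgroup Γ₀(N²) ∩ Γ₁(N) of SL(2, ℤ) to the quotient of ℍ by the action of Γ(N); that is, for z, w ∈ ℍ, z and w lie in the same Γ₀(N²) ∩ Γ₁(N)-orbit if and only if N·z and N·w lie in the same Γ(N)-orbit, and every Γ(N)-orbit in ℍ contains a point of the form N·z. -/

import Mathlib

open Matrix CongruenceSubgroup UpperHalfPlane

open scoped MatrixGroups

/-- For `N > 0`, multiplication by `N` maps the upper half plane to itself. -/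
noncomputable def UpperHalfPlane.scaleNat (N : ℕ) (hN : 0 < N) (z : UpperHalfPlane) :
    UpperHalfPlane :=
  ⟨(N : ℂ) * (z : ℂ), by
    simp only [Complex.mul_im, Complex.natCast_re, Complex.natCast_im, zero_mul, add_zero]
    exact mul_pos (by exact_mod_cast hN) z.2⟩

theorem UpperHalfPlane.coe_scaleNat (N : ℕ) (hN : 0 < N) (z : UpperHalfPlane) :
    (UpperHalfPlane.scaleNat N hN z : ℂ) = (N : ℂ) * (z : ℂ) := rfl

theorem UpperHalfPlane.scaleNat_bijective (N : ℕ) (hN : 0 < N) :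
    Function.Bijective (UpperHalfPlane.scaleNat N hN) := by
  have hN0 : (N : ℂ) ≠ 0 := by exact_mod_cast hN.ne'
  refine ⟨fun z w h ↦ ?_, fun w ↦ ?_⟩
  · have h' := congrArg UpperHalfPlane.coe h
    rw [coe_scaleNat, coe_scaleNat] at h'
    exact UpperHalfPlane.ext (mul_left_cancel₀ hN0 h')
  · let r : {x : ℝ // 0 < x} := ⟨(N : ℝ)⁻¹, by positivity⟩
    refine ⟨r • w, UpperHalfPlane.ext ?_⟩
    rw [coe_scaleNat, coe_pos_real_smul]
    simp [r, hN0]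

/-- The scaling `z ↦ N·z` intertwines `(a b; N·c d)` with `(a N·b; c d)`. -/
theorem UpperHalfPlane.smul_scaleNat (N : ℕ) (hN : 0 < N) (A B : SL(2, ℤ))
    (h00 : B 0 0 = A 0 0) (h01 : B 0 1 = N * A 0 1) (h10 : A 1 0 = N * B 1 0)
    (h11 : B 1 1 = A 1 1) (z : UpperHalfPlane) :
    B • UpperHalfPlane.scaleNat N hN z = UpperHalfPlane.scaleNat N hN (A • z) := by
  apply UpperHalfPlane.ext
  rw [coe_scaleNat, coe_specialLinearGroup_apply, coe_specialLinearGroup_apply, coe_scaleNat,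
    h00, h01, h10, h11]
  simp only [algebraMap_int_eq, eq_intCast, Int.cast_mul, Int.cast_natCast, Complex.ofReal_mul,
    Complex.ofReal_intCast, Complex.ofReal_natCast]
  rw [← mul_div_assoc]
  congr 1 <;> ring

/-- The map `z ↦ N·z` descends to a well-defined bijection from the quotient of `ℍ` by
`Γ₀(N²) ∩ Γ₁(N)` to the quotient of `ℍ` by `Γ(N)`: two points `z, w` lie in the same
`Γ₀(N²) ∩ Γ₁(N)`-orbit iff `N·z, N·w` lie in the same `Γ(N)`-orbit, and every
`Γ(N)`-orbit contains a point of the form `N·z`. -/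
theorem scale_descends_to_bijection_of_quotients (N : ℕ) (hN : 0 < N) :
    (∀ z w : UpperHalfPlane,
        (∃ A ∈ Gamma0 (N ^ 2) ⊓ Gamma1 N, A • z = w) ↔
          (∃ B ∈ Gamma N,
            B • UpperHalfPlane.scaleNat N hN z = UpperHalfPlane.scaleNat N hN w)) ∧
      (∀ w : UpperHalfPlane, ∃ z : UpperHalfPlane, ∃ B ∈ Gamma N,
        B • UpperHalfPlane.scaleNat N hN z = w) := by
  have hbij := UpperHalfPlane.scaleNat_bijective N hN
  refine ⟨fun z w ↦ ⟨?_, ?_⟩, fun w ↦ ?_⟩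
  · rintro ⟨A, hA, rfl⟩
    obtain ⟨hA0, hA1⟩ := Subgroup.mem_inf.mp hA
    rw [Gamma0_mem, ZMod.intCast_zmod_eq_zero_iff_dvd] at hA0
    obtain ⟨c, hc⟩ := hA0
    push_cast at hc
    obtain ⟨ha, hd, -⟩ := (Gamma1_mem N A).mp hA1
    have hdet := A.det_coe
    rw [Matrix.det_fin_two] at hdet
    let B : SL(2, ℤ) := ⟨!![A 0 0, N * A 0 1; N * c, A 1 1], by
      rw [Matrix.det_fin_two_of]
      linear_combination hdet + A 0 1 * hc⟩
    refine ⟨B, Gamma_mem.mpr ⟨ha, ?_, ?_, hd⟩,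
      UpperHalfPlane.smul_scaleNat N hN A B rfl rfl ?_ rfl z⟩
    · simp [B]
    · simp [B]
    · change A 1 0 = N * (N * c)
      rw [hc]
      ring
  · rintro ⟨B, hB, h⟩
    obtain ⟨ha, hb, hc, hd⟩ := Gamma_mem.mp hB
    rw [ZMod.intCast_zmod_eq_zero_iff_dvd] at hb hc
    obtain ⟨b, hb⟩ := hb
    obtain ⟨c, hc⟩ := hc
    have hdet := B.det_coe
    rw [Matrix.det_fin_two] at hdet
    let A : SL(2, ℤ) := ⟨!![B 0 0, b; N * B 1 0, B 1 1], by
      rw [Matrix.det_fin_two_of]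
      linear_combination hdet + B 1 0 * hb⟩
    refine ⟨A, Subgroup.mem_inf.mpr ⟨?_, ?_⟩, hbij.1 ?_⟩
    · rw [Gamma0_mem, ZMod.intCast_zmod_eq_zero_iff_dvd]
      refine ⟨c, ?_⟩
      change N * B 1 0 = _
      rw [hc]
      push_cast
      ring
    · exact (Gamma1_mem N A).mpr ⟨ha, hd, by simp [A]⟩
    · rw [← h]
      exact (UpperHalfPlane.smul_scaleNat N hN A B rfl hb rfl rfl z).symm
  · obtain ⟨z, rfl⟩ := hbij.2 w
    exact ⟨z, 1, one_mem _, one_smul _ _⟩
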